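/- Let 𝒬 be an imprecise Q-matrix with lower transition rate operator Q̲, let Q ∈ 𝒬, and let h ∈ ℝ^m be decomposed as h = h_n + h_e, where h_n satisfies Q h_n = Q̲ h_n (componentwise, i.e. h_n lies in the normal cone of 𝒬 at Q). Then ‖Q h − Q̲ h‖ ≤ ι(𝒬) · ‖h_e‖_c ≤ 2‖𝒬‖ · ‖h_e‖_c ≤ 2‖𝒬‖ · ‖h_e‖. -/

import Mathlib

/-- The sup norm `‖f‖ = max_i |f_i|` on `ℝᵐ`. -/
noncomputable def supNorm {m : ℕ} (f : Fin m → ℝ) : ℝ := ⨆ i, |f i|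

/-- Half the variational seminorm: `‖f‖_c = (max f − min f)/2`. -/
noncomputable def cNorm {m : ℕ} (f : Fin m → ℝ) : ℝ := ((⨆ i, f i) - ⨅ i, f i) / 2

/-- The matrix norm induced by the sup norm: `‖Q‖ = max_k ∑_l |Q k l|`. -/
noncomputable def matNorm {m : ℕ} (Q : Matrix (Fin m) (Fin m) ℝ) : ℝ := ⨆ k, ∑ l, |Q k l|

/-- A `Q`-matrix: nonnegative off-diagonal entries and zero row sums. -/
def IsQMatrix {m : ℕ} (Q : Matrix (Fin m) (Fin m) ℝ) : Prop :=
  (∀ k l, k ≠ l → 0 ≤ Q k l) ∧ ∀ k, ∑ l, Q k l = 0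

/-- An imprecise `Q`-matrix: a nonempty compact convex set of `Q`-matrices. -/
def IsImpreciseQMatrix {m : ℕ} (𝒬 : Set (Matrix (Fin m) (Fin m) ℝ)) : Prop :=
  𝒬.Nonempty ∧ IsCompact 𝒬 ∧ Convex ℝ 𝒬 ∧ ∀ Q ∈ 𝒬, IsQMatrix Q

/-- The lower transition rate operator `[Q̲ f]_k = min_{Q ∈ 𝒬} [Q f]_k`. -/
noncomputable def lowerQ {m : ℕ} (𝒬 : Set (Matrix (Fin m) (Fin m) ℝ)) (f : Fin m → ℝ) :
    Fin m → ℝ := fun k => sInf ((fun Q : Matrix (Fin m) (Fin m) ℝ => Q.mulVec f k) '' 𝒬)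

/-- The norm of a set of matrices: `‖𝒬‖ = max_{Q ∈ 𝒬} ‖Q‖`. -/
noncomputable def setNorm {m : ℕ} (𝒬 : Set (Matrix (Fin m) (Fin m) ℝ)) : ℝ :=
  sSup (matNorm '' 𝒬)

/-- The imprecision of `𝒬`: `ι(𝒬) = max_{Q, R ∈ 𝒬} ‖Q − R‖`. -/
noncomputable def iota {m : ℕ} (𝒬 : Set (Matrix (Fin m) (Fin m) ℝ)) : ℝ :=
  sSup ((fun p : Matrix (Fin m) (Fin m) ℝ × Matrix (Fin m) (Fin m) ℝ =>
    matNorm (p.1 - p.2)) '' (𝒬 ×ˢ 𝒬))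

section NormBounds

variable {m : ℕ}

lemma abs_le_supNorm (f : Fin m → ℝ) (i : Fin m) : |f i| ≤ supNorm f :=
  le_ciSup (f := fun i => |f i|) (Set.finite_range _).bddAbove i

lemma cNorm_le_supNorm (f : Fin m → ℝ) : cNorm f ≤ supNorm f := by
  rcases isEmpty_or_nonempty (Fin m) with _ | _
  · simp [cNorm, supNorm, Real.iSup_of_isEmpty, Real.iInf_of_isEmpty]
  · have h₁ : (⨆ i, f i) ≤ supNorm f :=
      ciSup_le fun i => (le_abs_self _).trans (abs_le_supNorm f i)
    have h₂ : -supNorm f ≤ ⨅ i, f i :=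
      le_ciInf fun i => (abs_le.1 (abs_le_supNorm f i)).1
    unfold cNorm
    linarith

/-- Every entry of `f` lies within `‖f‖_c` of the midrange of `f`. -/
lemma abs_sub_midrange_le_cNorm (f : Fin m → ℝ) (i : Fin m) :
    |f i - ((⨆ j, f j) + ⨅ j, f j) / 2| ≤ cNorm f := by
  have h₁ : f i ≤ ⨆ j, f j := le_ciSup (Set.finite_range f).bddAbove i
  have h₂ : (⨅ j, f j) ≤ f i := ciInf_le (Set.finite_range f).bddBelow i
  unfold cNorm
  rw [abs_le]
  constructor <;> linarith

lemma cNorm_nonneg (f : Fin m → ℝ) : 0 ≤ cNorm f := by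
  rcases isEmpty_or_nonempty (Fin m) with _ | ⟨⟨i⟩⟩
  · simp [cNorm, Real.iSup_of_isEmpty, Real.iInf_of_isEmpty]
  · exact (abs_nonneg _).trans (abs_sub_midrange_le_cNorm f i)

lemma rowSum_le_matNorm (A : Matrix (Fin m) (Fin m) ℝ) (k : Fin m) :
    ∑ l, |A k l| ≤ matNorm A :=
  le_ciSup (f := fun k => ∑ l, |A k l|) (Set.finite_range _).bddAbove k

lemma matNorm_nonneg (A : Matrix (Fin m) (Fin m) ℝ) : 0 ≤ matNorm A :=
  Real.iSup_nonneg fun _ => Finset.sum_nonneg fun _ _ => abs_nonneg _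

lemma matNorm_sub_le (A B : Matrix (Fin m) (Fin m) ℝ) :
    matNorm (A - B) ≤ matNorm A + matNorm B := by
  refine Real.iSup_le (fun k => ?_) (add_nonneg (matNorm_nonneg A) (matNorm_nonneg B))
  calc ∑ l, |(A - B) k l| ≤ ∑ l, (|A k l| + |B k l|) :=
        Finset.sum_le_sum fun l _ => abs_sub _ _
    _ = ∑ l, |A k l| + ∑ l, |B k l| := Finset.sum_add_distrib
    _ ≤ matNorm A + matNorm B := add_le_add (rowSum_le_matNorm A k) (rowSum_le_matNorm B k)

lemma abs_mulVec_le_of_rowSum_eq_zero (A : Matrix (Fin m) (Fin m) ℝ) (k : Fin m)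
    (hA : ∑ l, A k l = 0) (f : Fin m → ℝ) : |A.mulVec f k| ≤ matNorm A * cNorm f := by
  set c := ((⨆ j, f j) + ⨅ j, f j) / 2
  have key : A.mulVec f k = ∑ l, A k l * (f l - c) := by
    simp only [mul_sub, Finset.sum_sub_distrib, ← Finset.sum_mul, hA, zero_mul, sub_zero]
    rfl
  calc |A.mulVec f k| ≤ ∑ l, |A k l * (f l - c)| := by
        rw [key]
        exact Finset.abs_sum_le_sum_abs _ _
    _ ≤ ∑ l, |A k l| * cNorm f := Finset.sum_le_sum fun l _ => by
        rw [abs_mul]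
        exact mul_le_mul_of_nonneg_left (abs_sub_midrange_le_cNorm f l) (abs_nonneg _)
    _ = (∑ l, |A k l|) * cNorm f := (Finset.sum_mul ..).symm
    _ ≤ matNorm A * cNorm f :=
        mul_le_mul_of_nonneg_right (rowSum_le_matNorm A k) (cNorm_nonneg f)

lemma IsCompact.bddAbove_matNorm {𝒬 : Set (Matrix (Fin m) (Fin m) ℝ)} (h𝒬 : IsCompact 𝒬) :
    BddAbove (matNorm '' 𝒬) := by
  have hcont : Continuous fun A : Matrix (Fin m) (Fin m) ℝ => ∑ k, ∑ l, |A k l| :=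
    continuous_finsetSum _ fun k _ => continuous_finsetSum _ fun l _ =>
      (continuous_id.matrix_elem k l).abs
  obtain ⟨M, hM⟩ := h𝒬.bddAbove_image hcont.continuousOn
  refine ⟨M, ?_⟩
  rintro _ ⟨A, hA, rfl⟩
  refine le_trans ?_ (hM ⟨A, hA, rfl⟩)
  have hrow : ∀ k, 0 ≤ ∑ l, |A k l| := fun k => Finset.sum_nonneg fun l _ => abs_nonneg _
  exact Real.iSup_le (fun k => Finset.single_le_sum (f := fun k => ∑ l, |A k l|)
    (fun k _ => hrow k) (Finset.mem_univ k)) (Finset.sum_nonneg fun k _ => hrow k)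

lemma lowerQ_le {𝒬 : Set (Matrix (Fin m) (Fin m) ℝ)} (h𝒬 : IsCompact 𝒬)
    {Q : Matrix (Fin m) (Fin m) ℝ} (hQ : Q ∈ 𝒬) (f : Fin m → ℝ) (k : Fin m) :
    lowerQ 𝒬 f k ≤ Q.mulVec f k := by
  have hcont : Continuous fun A : Matrix (Fin m) (Fin m) ℝ => A.mulVec f k :=
    (continuous_apply k).comp (continuous_id.matrix_mulVec continuous_const)
  exact csInf_le (h𝒬.bddBelow_image hcont.continuousOn) ⟨Q, hQ, rfl⟩

lemma setNorm_nonneg (𝒬 : Set (Matrix (Fin m) (Fin m) ℝ)) : 0 ≤ setNorm 𝒬 := by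
  refine Real.sSup_nonneg ?_
  rintro _ ⟨A, _, rfl⟩
  exact matNorm_nonneg A

lemma matNorm_sub_le_two_mul_setNorm {𝒬 : Set (Matrix (Fin m) (Fin m) ℝ)} (h𝒬 : IsCompact 𝒬)
    {A B : Matrix (Fin m) (Fin m) ℝ} (hA : A ∈ 𝒬) (hB : B ∈ 𝒬) :
    matNorm (A - B) ≤ 2 * setNorm 𝒬 := by
  have h₁ : matNorm A ≤ setNorm 𝒬 := le_csSup h𝒬.bddAbove_matNorm ⟨A, hA, rfl⟩
  have h₂ : matNorm B ≤ setNorm 𝒬 := le_csSup h𝒬.bddAbove_matNorm ⟨B, hB, rfl⟩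
  linarith [matNorm_sub_le A B]

lemma matNorm_sub_le_iota {𝒬 : Set (Matrix (Fin m) (Fin m) ℝ)} (h𝒬 : IsCompact 𝒬)
    {A B : Matrix (Fin m) (Fin m) ℝ} (hA : A ∈ 𝒬) (hB : B ∈ 𝒬) :
    matNorm (A - B) ≤ iota 𝒬 := by
  refine le_csSup ⟨2 * setNorm 𝒬, ?_⟩ ⟨(A, B), ⟨hA, hB⟩, rfl⟩
  rintro _ ⟨p, hp, rfl⟩
  exact matNorm_sub_le_two_mul_setNorm h𝒬 hp.1 hp.2

lemma iota_nonneg (𝒬 : Set (Matrix (Fin m) (Fin m) ℝ)) : 0 ≤ iota 𝒬 := by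
  refine Real.sSup_nonneg ?_
  rintro _ ⟨p, _, rfl⟩
  exact matNorm_nonneg _

lemma iota_le_two_mul_setNorm {𝒬 : Set (Matrix (Fin m) (Fin m) ℝ)} (h𝒬 : IsCompact 𝒬) :
    iota 𝒬 ≤ 2 * setNorm 𝒬 := by
  refine Real.sSup_le ?_ (mul_nonneg zero_le_two (setNorm_nonneg 𝒬))
  rintro _ ⟨p, hp, rfl⟩
  exact matNorm_sub_le_two_mul_setNorm h𝒬 hp.1 hp.2

end NormBounds

/-- Let `𝒬` be an imprecise `Q`-matrix, `Q ∈ 𝒬`, and `h = h_n + h_e` where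
`Q h_n = Q̲ h_n` (i.e. `h_n` lies in the normal cone of `𝒬` at `Q`).  Then
`‖Qh − Q̲h‖ ≤ ι(𝒬)·‖h_e‖_c ≤ 2‖𝒬‖·‖h_e‖_c ≤ 2‖𝒬‖·‖h_e‖`. -/
theorem normalCone_error_bound {m : ℕ} (𝒬 : Set (Matrix (Fin m) (Fin m) ℝ))
    (h𝒬 : IsImpreciseQMatrix 𝒬) (Q : Matrix (Fin m) (Fin m) ℝ) (hQ : Q ∈ 𝒬)
    (h hn he : Fin m → ℝ) (hsum : h = hn + he)
    (hcone : Q.mulVec hn = lowerQ 𝒬 hn) :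
    supNorm (Q.mulVec h - lowerQ 𝒬 h) ≤ iota 𝒬 * cNorm he ∧
    iota 𝒬 * cNorm he ≤ 2 * setNorm 𝒬 * cNorm he ∧
    2 * setNorm 𝒬 * cNorm he ≤ 2 * setNorm 𝒬 * supNorm he := by
  obtain ⟨hne, hcomp, -, hmat⟩ := h𝒬
  refine ⟨?_, mul_le_mul_of_nonneg_right (iota_le_two_mul_setNorm hcomp) (cNorm_nonneg he),
    mul_le_mul_of_nonneg_left (cNorm_le_supNorm he)
      (mul_nonneg zero_le_two (setNorm_nonneg 𝒬))⟩
  refine Real.iSup_le (fun k => ?_) (mul_nonneg (iota_nonneg 𝒬) (cNorm_nonneg he))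
  have hlow : Q.mulVec h k - iota 𝒬 * cNorm he ≤ lowerQ 𝒬 h k := by
    refine le_csInf (hne.image _) ?_
    rintro _ ⟨P, hP, rfl⟩
    have hrow : ∑ l, (Q - P) k l = 0 := by
      simp [Finset.sum_sub_distrib, (hmat Q hQ).2 k, (hmat P hP).2 k]
    have herr : (Q - P).mulVec he k ≤ iota 𝒬 * cNorm he :=
      (le_abs_self _).trans <| (abs_mulVec_le_of_rowSum_eq_zero _ k hrow he).trans <|
        mul_le_mul_of_nonneg_right (matNorm_sub_le_iota hcomp hQ hP) (cNorm_nonneg he)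
    have hnormal : Q.mulVec hn k ≤ P.mulVec hn k := by
      rw [hcone]
      exact lowerQ_le hcomp hP hn k
    simp only [hsum, Matrix.mulVec_add, Matrix.sub_mulVec, Pi.add_apply, Pi.sub_apply] at herr ⊢
    linarith
  rw [Pi.sub_apply, abs_of_nonneg (sub_nonneg.2 (lowerQ_le hcomp hQ h k))]
  linarith
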